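/- Parseval identity for the matrix-valued Fourier transform. Let G be a finite group and {σ_λ}_{λ∈Irr} a complete set of pairwise inequivalent irreducible unitary representations of G over ℂ, with d_λ the dimension of σ_λ. Then for any maps φ, φ': G → M_{d'}(ℂ), (1/|G|) Σ_{g∈G} tr( φ(g)† · φ'(g) ) = Σ_{λ∈Irr} d_λ · tr( F(φ)[σ_λ]† · F(φ')[σ_λ] ). -/

import Mathlib

open scoped Matrix Kronecker BigOperators

namespace RB

variable {G : Type} [Group G] [Fintype G]

/-- Convolution of matrix-valued maps on a finite group:
`(φ * φ')(g) = |G|⁻¹ Σ_{g'} φ(g g'⁻¹) φ'(g')`. -/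
noncomputable def convMap {d' : ℕ} (φ φ' : G → Matrix (Fin d') (Fin d') ℂ) :
    G → Matrix (Fin d') (Fin d') ℂ :=
  fun g => (Fintype.card G : ℂ)⁻¹ • ∑ g' : G, φ (g * g'⁻¹) * φ' g'

/-- The matrix-valued Fourier transform of `φ` at a representation `σ`:
`F(φ)[σ] = |G|⁻¹ Σ_g conj(σ(g)) ⊗ φ(g)`. -/
noncomputable def fourierTransform {dσ d' : ℕ} (φ : G → Matrix (Fin d') (Fin d') ℂ)
    (σ : G → Matrix (Fin dσ) (Fin dσ) ℂ) :
    Matrix (Fin dσ × Fin d') (Fin dσ × Fin d') ℂ :=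
  (Fintype.card G : ℂ)⁻¹ • ∑ g : G, ((σ g).map (starRingEnd ℂ)) ⊗ₖ (φ g)

/-- Partial trace over the first tensor factor. -/
noncomputable def partialTraceFst {a b : ℕ} (A : Matrix (Fin a × Fin b) (Fin a × Fin b) ℂ) :
    Matrix (Fin b) (Fin b) ℂ :=
  Matrix.of fun j k => ∑ i : Fin a, A (i, j) (i, k)

/-- Irreducibility of a matrix representation: no nontrivial invariant subspace. -/
def Irreducible {k : ℕ} (σ : G →* Matrix (Fin k) (Fin k) ℂ) : Prop :=
  ∀ p : Submodule ℂ (Fin k → ℂ), (∀ g : G, ∀ x ∈ p, (σ g).mulVec x ∈ p) → p = ⊥ ∨ p = ⊤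

/-- Equivalence of matrix representations: a bijective intertwiner. -/
def RepEquiv {k l : ℕ} (σ : G →* Matrix (Fin k) (Fin k) ℂ)
    (τ : G →* Matrix (Fin l) (Fin l) ℂ) : Prop :=
  ∃ T : Matrix (Fin k) (Fin l) ℂ,
    Function.Bijective T.mulVecLin ∧ ∀ g : G, σ g * T = T * τ g

end RB

namespace RB

variable {G : Type} [Group G]

/-- Schur's lemma: an intertwiner between irreducible matrix representations vanishes or is
bijective. -/
theorem Irreducible.intertwiner_eq_zero_or_bijective {k l : ℕ}
    {σ : G →* Matrix (Fin k) (Fin k) ℂ} {τ : G →* Matrix (Fin l) (Fin l) ℂ}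
    (hσ : Irreducible σ) (hτ : Irreducible τ) (T : Matrix (Fin k) (Fin l) ℂ)
    (hT : ∀ g, σ g * T = T * τ g) : T = 0 ∨ Function.Bijective T.mulVecLin := by
  have hzero : T.mulVecLin = 0 → T = 0 := fun h => by
    apply Matrix.toLin'.injective
    rw [Matrix.toLin'_apply', h, map_zero]
  rcases hτ (LinearMap.ker T.mulVecLin) (fun g x hx => by
    simp only [LinearMap.mem_ker, Matrix.mulVecLin_apply] at hx ⊢
    rw [Matrix.mulVec_mulVec, ← hT, ← Matrix.mulVec_mulVec, hx, Matrix.mulVec_zero]) with hk | hk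
  · rcases hσ (LinearMap.range T.mulVecLin) (fun g x hx => by
      obtain ⟨y, rfl⟩ := hx
      refine ⟨(τ g).mulVec y, ?_⟩
      simp only [Matrix.mulVecLin_apply, Matrix.mulVec_mulVec, hT]) with hr | hr
    · exact Or.inl (hzero (LinearMap.range_eq_bot.mp hr))
    · exact Or.inr ⟨LinearMap.ker_eq_bot.mp hk, LinearMap.range_eq_top.mp hr⟩
  · exact Or.inl (hzero (LinearMap.ker_eq_top.mp hk))

/-- Schur's lemma over `ℂ`: a matrix commuting with an irreducible representation is scalar. -/
theorem Irreducible.exists_eq_smul_one {k : ℕ} {σ : G →* Matrix (Fin k) (Fin k) ℂ}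
    (hσ : Irreducible σ) (T : Matrix (Fin k) (Fin k) ℂ) (hT : ∀ g, σ g * T = T * σ g) :
    ∃ c : ℂ, T = c • 1 := by
  rcases Nat.eq_zero_or_pos k with rfl | hk
  · exact ⟨0, Subsingleton.elim _ _⟩
  have : Nonempty (Fin k) := ⟨⟨0, hk⟩⟩
  obtain ⟨c, hc⟩ := Module.End.exists_eigenvalue T.mulVecLin
  obtain ⟨v, hv⟩ := hc.exists_hasEigenvector
  refine ⟨c, sub_eq_zero.mp ?_⟩
  refine (hσ.intertwiner_eq_zero_or_bijective hσ (T - c • 1) fun g => ?_).resolve_right fun hb => ?_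
  · simp [mul_sub, sub_mul, hT]
  · refine hv.2 (hb.1 ?_)
    have h := hv.apply_eq_smul
    simp only [Matrix.mulVecLin_apply] at h
    simp [h]

variable [Fintype G]

/-- The group average `∑ g, σ g * M * τ g⁻¹` intertwines `σ` and `τ`. -/
theorem mul_sum_conj_eq {k l : ℕ} (σ : G →* Matrix (Fin k) (Fin k) ℂ)
    (τ : G →* Matrix (Fin l) (Fin l) ℂ) (M : Matrix (Fin k) (Fin l) ℂ) (h : G) :
    σ h * (∑ g, σ g * M * τ g⁻¹) = (∑ g, σ g * M * τ g⁻¹) * τ h := by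
  rw [Matrix.mul_sum, Matrix.sum_mul]
  refine Fintype.sum_equiv (Equiv.mulLeft h) _ _ fun g => ?_
  simp only [Equiv.coe_mulLeft, mul_inv_rev, map_mul, Matrix.mul_assoc]
  rw [← map_mul τ h⁻¹ h, inv_mul_cancel, map_one, Matrix.mul_one]

theorem sum_conj_single_apply {k l : ℕ} (σ : G →* Matrix (Fin k) (Fin k) ℂ)
    (τ : G →* Matrix (Fin l) (Fin l) ℂ) (a b : Fin k) (i j : Fin l) :
    (∑ g, σ g * (Matrix.single b i 1 : Matrix (Fin k) (Fin l) ℂ) * τ g⁻¹) a j =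
      ∑ g, σ g a b * τ g⁻¹ i j := by
  rw [Matrix.sum_apply]
  refine Finset.sum_congr rfl fun g _ => ?_
  rw [Matrix.mul_assoc, Matrix.mul_apply, Finset.sum_eq_single b]
  · simp
  · intro c _ hc
    simp [hc]
  · simp

theorem sum_trace_inv_smul_eq_zero {k l : ℕ} {σ : G →* Matrix (Fin k) (Fin k) ℂ}
    {τ : G →* Matrix (Fin l) (Fin l) ℂ} (hσ : Irreducible σ) (hτ : Irreducible τ)
    (h : ¬ RepEquiv σ τ) : ∑ g, (τ g⁻¹).trace • σ g = 0 := by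
  ext a b
  simp only [Matrix.sum_apply, Matrix.smul_apply, Matrix.trace, Matrix.diag_apply, smul_eq_mul,
    Finset.sum_mul, Matrix.zero_apply]
  rw [Finset.sum_comm]
  refine Finset.sum_eq_zero fun i _ => ?_
  have hT := mul_sum_conj_eq σ τ (Matrix.single b i 1)
  have h0 := (hσ.intertwiner_eq_zero_or_bijective hτ _ hT).resolve_right fun hb => h ⟨_, hb, hT⟩
  simp only [mul_comm (τ _ _ _), ← sum_conj_single_apply, h0, Matrix.zero_apply]

theorem natCast_smul_sum_trace_inv_smul {k : ℕ} {σ : G →* Matrix (Fin k) (Fin k) ℂ}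
    (hσ : Irreducible σ) :
    (k : ℂ) • ∑ g, (σ g⁻¹).trace • σ g = (Fintype.card G : ℂ) • 1 := by
  ext a b
  simp only [Matrix.sum_apply, Matrix.smul_apply, Matrix.trace, Matrix.diag_apply, smul_eq_mul,
    Finset.sum_mul]
  rw [Finset.sum_comm, Finset.mul_sum]
  have key : ∀ i, (k : ℂ) * ∑ g, σ g⁻¹ i i * σ g a b =
      if b = i then (Fintype.card G : ℂ) * (1 : Matrix (Fin k) (Fin k) ℂ) a i else 0 := fun i => by
    obtain ⟨c, hc⟩ := hσ.exists_eq_smul_one _ (mul_sum_conj_eq σ σ (Matrix.single b i 1))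
    have htr : (Fintype.card G : ℂ) * (if b = i then 1 else 0) = c * k := by
      have h := congrArg Matrix.trace hc
      rw [Matrix.trace_sum, Matrix.trace_smul, Matrix.trace_one, Fintype.card_fin] at h
      rw [smul_eq_mul] at h
      rw [← h, Finset.sum_congr rfl (g := fun _ => if b = i then (1 : ℂ) else 0)]
      · simp
      · intro g _
        rw [Matrix.mul_assoc, Matrix.trace_mul_comm, Matrix.mul_assoc, ← map_mul, inv_mul_cancel,
          map_one, Matrix.mul_one]
        split_ifs with hbi
        · subst hbi; simp
        · exact Matrix.trace_single_eq_of_ne _ _ _ hbi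
    simp only [mul_comm (σ _ i i), ← sum_conj_single_apply, hc, Matrix.smul_apply, smul_eq_mul]
    rw [← mul_assoc, mul_comm (k : ℂ), ← htr]
    split_ifs <;> simp
  simp [key]

/-- The restriction of a representation to an invariant subspace. -/
def restrictRep {V : Type} [AddCommGroup V] [Module ℂ V] (ρ : G →* Module.End ℂ V)
    (p : Submodule ℂ V) (hp : ∀ g, ∀ x ∈ p, ρ g x ∈ p) : G →* Module.End ℂ p where
  toFun g := (ρ g).restrict (hp g)
  map_one' := by ext; simp
  map_mul' g h := by ext; simp

/-- If `∑ g, r g • τ g = 0` for all irreducible unitary matrix representations `τ`, then the same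
holds for every finite-dimensional unitary representation. -/
theorem sum_smul_eq_zero_of_irreducible (r : G → ℂ)
    (hr : ∀ (k : ℕ) (τ : G →* Matrix (Fin k) (Fin k) ℂ),
      (∀ g, τ g ∈ Matrix.unitaryGroup (Fin k) ℂ) → Irreducible τ → ∑ g, r g • τ g = 0)
    {V : Type} [NormedAddCommGroup V] [InnerProductSpace ℂ V] [FiniteDimensional ℂ V]
    (ρ : G →* Module.End ℂ V) (hρ : ∀ g x y, inner ℂ (ρ g x) (ρ g y) = inner ℂ x y) :
    ∑ g, r g • ρ g = 0 := by
  induction hn : Module.finrank ℂ V using Nat.strong_induction_on generalizing V with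
  | _ n ih =>
  by_cases hirr : ∀ p : Submodule ℂ V, (∀ g, ∀ x ∈ p, ρ g x ∈ p) → p = ⊥ ∨ p = ⊤
  · let b := stdOrthonormalBasis ℂ V
    let e := LinearMap.toMatrixOrthonormal b
    let τ : G →* Matrix (Fin (Module.finrank ℂ V)) (Fin (Module.finrank ℂ V)) ℂ :=
      (e : Module.End ℂ V →* _).comp ρ
    have hτ : ∀ g x, (τ g).mulVec (b.toBasis.equivFun x) = b.toBasis.equivFun (ρ g x) :=
      fun g x => LinearMap.toMatrix_mulVec_repr b.toBasis b.toBasis (ρ g) x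
    have h0 := hr _ τ (fun g => ?_) fun p hp => ?_
    · apply e.injective
      rw [map_zero, map_sum, ← h0]
      exact Finset.sum_congr rfl fun g _ => map_smul e (r g) (ρ g)
    · rw [Matrix.mem_unitaryGroup_iff']
      change star (e (ρ g)) * e (ρ g) = 1
      rw [← map_star, ← map_mul, ← map_one e]
      congr 1
      ext x
      refine ext_inner_left ℂ fun y => ?_
      rw [Module.End.mul_apply, LinearMap.star_eq_adjoint, LinearMap.adjoint_inner_right, hρ,
        Module.End.one_apply]
    · have hsurj := b.toBasis.equivFun.surjective
      rcases hirr (p.comap b.toBasis.equivFun.toLinearMap) (fun g x hx => by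
        have hx' := hp g _ hx
        rwa [LinearEquiv.coe_coe, hτ] at hx') with h | h
      · left
        rw [eq_bot_iff]
        intro y hy
        obtain ⟨x, rfl⟩ := hsurj y
        have : x ∈ p.comap b.toBasis.equivFun.toLinearMap := hy
        rw [h, Submodule.mem_bot] at this
        simp [this]
      · right
        rw [eq_top_iff]
        intro y _
        obtain ⟨x, rfl⟩ := hsurj y
        have : x ∈ p.comap b.toBasis.equivFun.toLinearMap := h ▸ Submodule.mem_top
        exact this
  · push Not at hirr
    obtain ⟨p, hp, hbot, htop⟩ := hirr
    have hp' : ∀ g, ∀ x ∈ pᗮ, ρ g x ∈ pᗮ := fun g x hx y hy => by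
      have := hρ g (ρ g⁻¹ y) x
      rw [← Module.End.mul_apply, ← map_mul, mul_inv_cancel, map_one, Module.End.one_apply] at this
      rw [this]
      exact hx _ (hp _ _ hy)
    have hsub : ∀ q : Submodule ℂ V, (∀ g, ∀ x ∈ q, ρ g x ∈ q) → q ≠ ⊤ →
        ∀ x ∈ q, (∑ g, r g • ρ g) x = 0 := fun q hq hne x hx => by
      have h := ih _ (hn ▸ Submodule.finrank_lt hne) (restrictRep ρ q hq)
        (fun g y z => hρ g y z) rfl
      have h' := congrArg Subtype.val (LinearMap.congr_fun h ⟨x, hx⟩)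
      simpa [LinearMap.sum_apply, restrictRep] using h'
    ext x
    obtain ⟨y, hy, z, hz, rfl⟩ := p.exists_add_mem_mem_orthogonal x
    rw [map_add, hsub p hp htop y hy, hsub pᗮ hp' (by
      rwa [Ne, Submodule.orthogonal_eq_top_iff]) z hz]
    simp

/-- The left regular representation on `ℓ²(G)`. -/
noncomputable def leftRegular (G : Type) [Group G] [Fintype G] :
    G →* Module.End ℂ (EuclideanSpace ℂ G) where
  toFun g :=
    { toFun := fun x => WithLp.toLp 2 fun h => x (g⁻¹ * h)
      map_add' := fun _ _ => by ext; simp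
      map_smul' := fun _ _ => by ext; simp }
  map_one' := by ext; simp
  map_mul' g h := by ext; simp [mul_assoc]

/-- A function on `G` annihilated by all irreducible unitary matrix representations is zero. -/
theorem eq_zero_of_irreducible (r : G → ℂ)
    (hr : ∀ (k : ℕ) (τ : G →* Matrix (Fin k) (Fin k) ℂ),
      (∀ g, τ g ∈ Matrix.unitaryGroup (Fin k) ℂ) → Irreducible τ → ∑ g, r g • τ g = 0) :
    r = 0 := by
  classical
  have h := sum_smul_eq_zero_of_irreducible r hr (leftRegular G) fun g x y => by
    simp only [PiLp.inner_apply, leftRegular, MonoidHom.coe_mk, OneHom.coe_mk, LinearMap.coe_mk,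
      AddHom.coe_mk]
    exact Fintype.sum_equiv (Equiv.mulLeft g⁻¹) _ _ fun _ => rfl
  ext a
  have h' := congrArg (fun v : EuclideanSpace ℂ G => v a)
    (LinearMap.congr_fun h (EuclideanSpace.single 1 1))
  simpa [LinearMap.sum_apply, leftRegular, inv_mul_eq_one, Pi.single_apply] using h'

/-- The character of the regular representation: `∑ l, d_l χ_l(g) = |G| δ_{g,1}`. -/
theorem sum_dim_mul_trace [DecidableEq G] {Λ : Type} [Fintype Λ] {dims : Λ → ℕ}
    {σ : ∀ l : Λ, G →* Matrix (Fin (dims l)) (Fin (dims l)) ℂ}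
    (hirred : ∀ l : Λ, Irreducible (σ l))
    (hinequiv : ∀ l l' : Λ, l ≠ l' → ¬ RepEquiv (σ l) (σ l'))
    (hcomplete : ∀ (k : ℕ) (τ : G →* Matrix (Fin k) (Fin k) ℂ),
      (∀ g : G, τ g ∈ Matrix.unitaryGroup (Fin k) ℂ) → Irreducible τ →
        ∃ l : Λ, RepEquiv τ (σ l)) (g : G) :
    ∑ l, (dims l : ℂ) * (σ l g).trace = if g = 1 then (Fintype.card G : ℂ) else 0 := by
  have hr := eq_zero_of_irreducible (G := G)
    (fun g => (∑ l, (dims l : ℂ) * (σ l g⁻¹).trace) - if g = 1 then (Fintype.card G : ℂ) else 0) ?_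
  · have := congrFun hr g⁻¹
    simpa [sub_eq_zero] using this
  intro k τ hτu hτ
  obtain ⟨m, T, hT, hint⟩ := hcomplete k τ hτu hτ
  have hσ : ∑ g, ((∑ l, (dims l : ℂ) * (σ l g⁻¹).trace) -
      if g = 1 then (Fintype.card G : ℂ) else 0) • σ m g = 0 := by
    simp only [sub_smul, Finset.sum_sub_distrib, Finset.sum_smul, ite_smul, zero_smul,
      Finset.sum_ite_eq', Finset.mem_univ, if_true, map_one, mul_smul]
    rw [Finset.sum_comm, Finset.sum_eq_single m]
    · rw [← Finset.smul_sum, natCast_smul_sum_trace_inv_smul (hirred m), sub_self]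
    · intro l _ hl
      rw [← Finset.smul_sum,
        sum_trace_inv_smul_eq_zero (hirred m) (hirred l) (hinequiv m l hl.symm),
        smul_zero]
    · simp
  set r : G → ℂ := fun g => (∑ l, (dims l : ℂ) * (σ l g⁻¹).trace) -
      if g = 1 then (Fintype.card G : ℂ) else 0
  have hmul : (∑ g, r g • τ g) * T = 0 := by
    calc (∑ g, r g • τ g) * T = T * ∑ g, r g • σ m g := by
          simp only [Matrix.sum_mul, Matrix.mul_sum, Matrix.smul_mul, Matrix.mul_smul, hint]
      _ = 0 := by rw [hσ, Matrix.mul_zero]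
  apply Matrix.toLin'.injective
  refine LinearMap.ext fun y => ?_
  obtain ⟨x, rfl⟩ := hT.2 y
  rw [Matrix.toLin'_apply, Matrix.mulVecLin_apply, Matrix.mulVec_mulVec, hmul]
  simp

/-- The Hilbert–Schmidt pairing of two Fourier transforms in terms of the character. -/
theorem trace_fourierTransform_conjTranspose_mul {k d' : ℕ}
    (σ : G →* Matrix (Fin k) (Fin k) ℂ) (hσ : ∀ g, σ g ∈ Matrix.unitaryGroup (Fin k) ℂ)
    (φ φ' : G → Matrix (Fin d') (Fin d') ℂ) :
    ((fourierTransform φ σ)ᴴ * fourierTransform φ' σ).trace =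
      (Fintype.card G : ℂ)⁻¹ * (Fintype.card G : ℂ)⁻¹ *
        ∑ g, ∑ h, (σ (g * h⁻¹)).trace * ((φ g)ᴴ * φ' h).trace := by
  have hinv : ∀ h, σ h⁻¹ = (σ h)ᴴ := fun h => by
    have h1 : σ h⁻¹ * σ h = 1 := by rw [← map_mul, inv_mul_cancel, map_one]
    exact left_inv_eq_right_inv h1 (Matrix.mem_unitaryGroup_iff.mp (hσ h))
  have htr : ∀ g h, (((σ g).map (starRingEnd ℂ))ᴴ * (σ h).map (starRingEnd ℂ)).trace =
      (σ (g * h⁻¹)).trace := fun g h => by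
    rw [map_mul, hinv, ← Matrix.trace_transpose (_ * (σ h)ᴴ), Matrix.transpose_mul,
      Matrix.trace_mul_comm]
    congr 2
    ext i j
    simp
  simp only [fourierTransform, Matrix.conjTranspose_smul, Matrix.conjTranspose_sum, Matrix.smul_mul,
    Matrix.mul_smul, Matrix.trace_smul, Matrix.sum_mul, Matrix.mul_sum, Matrix.trace_sum,
    Matrix.conjTranspose_kronecker, ← Matrix.mul_kronecker_mul, Matrix.trace_kronecker, htr,
    smul_eq_mul, star_inv₀, star_natCast]
  rw [← Finset.mul_sum, Finset.sum_comm, mul_assoc]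

end RB

open RB in
/-- Parseval identity for the matrix-valued Fourier transform. -/
theorem fourier_parseval
    {G : Type} [Group G] [Fintype G]
    (Λ : Type) [Fintype Λ]
    (dims : Λ → ℕ)
    (σ : ∀ l : Λ, G →* Matrix (Fin (dims l)) (Fin (dims l)) ℂ)
    (hunitary : ∀ (l : Λ) (g : G), σ l g ∈ Matrix.unitaryGroup (Fin (dims l)) ℂ)
    (hirred : ∀ l : Λ, Irreducible (σ l))
    (hinequiv : ∀ l l' : Λ, l ≠ l' → ¬ RepEquiv (σ l) (σ l'))
    (hcomplete : ∀ (k : ℕ) (τ : G →* Matrix (Fin k) (Fin k) ℂ),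
      (∀ g : G, τ g ∈ Matrix.unitaryGroup (Fin k) ℂ) → Irreducible τ →
        ∃ l : Λ, RepEquiv τ (σ l))
    (d' : ℕ) (φ φ' : G → Matrix (Fin d') (Fin d') ℂ) :
    (Fintype.card G : ℂ)⁻¹ * ∑ g : G, ((φ g)ᴴ * φ' g).trace
      = ∑ l : Λ, (dims l : ℂ) *
          ((fourierTransform φ (σ l : G → Matrix (Fin (dims l)) (Fin (dims l)) ℂ))ᴴ *
            fourierTransform φ' (σ l : G → Matrix (Fin (dims l)) (Fin (dims l)) ℂ)).trace := by
  classical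
  simp only [trace_fourierTransform_conjTranspose_mul _ (hunitary _)]
  calc (Fintype.card G : ℂ)⁻¹ * ∑ g : G, ((φ g)ᴴ * φ' g).trace
      = (Fintype.card G : ℂ)⁻¹ * (Fintype.card G : ℂ)⁻¹ * ∑ g : G, ∑ h : G,
          (∑ l, (dims l : ℂ) * (σ l (g * h⁻¹)).trace) * ((φ g)ᴴ * φ' h).trace := by
        simp only [sum_dim_mul_trace hirred hinequiv hcomplete, mul_inv_eq_one, ite_mul, zero_mul,
          Finset.sum_ite_eq, Finset.mem_univ, if_true, ← Finset.mul_sum]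
        field_simp
    _ = _ := by
        simp only [mul_left_comm (dims _ : ℂ), ← Finset.mul_sum]
        congr 1
        simp only [Finset.sum_mul, Finset.mul_sum, mul_assoc]
        symm
        rw [Finset.sum_comm]
        exact Finset.sum_congr rfl fun g _ => Finset.sum_comm
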